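/- arXiv:1002.1763 — 3 statements merged into one kernel-verified Lean document; each statement's English description precedes it below -/
import Mathlib

section
/- For every integer n ≥ 1 and all reals p, q with 0 < q < p, p + q < 1 and p ≤ 1/(2n+1) + q, one has J_n(q, p) > 0; equivalently, f(n+1, p, q) > f(n, p, q). -/
/-- `f n p q` is the probability that in `n` independent tosses each, a coin with heads
probability `q` produces strictly more heads than a coin with heads probability `p`. -/
noncomputable def f (n : ℕ) (p q : ℝ) : ℝ :=
  ∑ r ∈ Finset.range (n + 1), ∑ s ∈ Finset.Icc (r + 1) n,
    (n.choose r : ℝ) * p ^ r * (1 - p) ^ (n - r) *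
      ((n.choose s : ℝ) * q ^ s * (1 - q) ^ (n - s))
noncomputable def phi (n : ℕ) (z : ℝ) : ℝ :=
  ∑ r ∈ Finset.range (n + 1), (n.choose r : ℝ) ^ 2 * z ^ r
/-- `psi n z = Σ_{r=0}^{n-1} C(n,r+1) C(n,r) z^(r+1)`. -/
noncomputable def psi (n : ℕ) (z : ℝ) : ℝ :=
  ∑ r ∈ Finset.range n, (n.choose (r + 1) : ℝ) * (n.choose r : ℝ) * z ^ (r + 1)
/-- The indicator function `J n q p = (q/(1−q)) φ_n(z) − ψ_n(z)` with
`z = pq/((1−p)(1−q))`. -/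
noncomputable def J (n : ℕ) (q p : ℝ) : ℝ :=
  (q / (1 - q)) * phi n (p * q / ((1 - p) * (1 - q))) -
    psi n (p * q / ((1 - p) * (1 - q)))

lemma aux_phi_rec (n : ℕ) (z : ℝ) : phi (n + 1) z = (1 + z) * phi n z + 2 * psi n z := by
  have e1 : phi (n + 1) z = 1 + ∑ r ∈ Finset.range (n + 1),
      ((n.choose r : ℝ) + (n.choose (r + 1) : ℝ)) ^ 2 * z ^ (r + 1) := by
    unfold phi
    rw [Finset.sum_range_succ']
    simp only [Nat.choose_succ_succ, Nat.choose_zero_right]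
    push_cast
    ring
  have e2 : phi n z = 1 + ∑ r ∈ Finset.range (n + 1),
      (n.choose (r + 1) : ℝ) ^ 2 * z ^ (r + 1) := by
    unfold phi
    rw [Finset.sum_range_succ', Finset.sum_range_succ]
    simp
    ring
  have e3 : psi n z = ∑ r ∈ Finset.range (n + 1),
      (n.choose (r + 1) : ℝ) * (n.choose r : ℝ) * z ^ (r + 1) := by
    unfold psi
    rw [Finset.sum_range_succ]
    simp
  have e4 : z * phi n z = ∑ r ∈ Finset.range (n + 1), (n.choose r : ℝ) ^ 2 * z ^ (r + 1) := by
    unfold phi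
    rw [Finset.mul_sum]
    refine Finset.sum_congr rfl fun r _ => ?_
    ring
  have : (1 + z) * phi n z + 2 * psi n z = phi n z + z * phi n z + 2 * psi n z := by ring
  rw [this, e4, e3, e2, e1, Finset.mul_sum, add_assoc, add_assoc, ← Finset.sum_add_distrib,
    ← Finset.sum_add_distrib]
  congr 1
  refine Finset.sum_congr rfl fun r _ => ?_
  ring

lemma aux_choose (n r : ℕ) : ((n : ℝ) + 2) * (((n + 1).choose (r + 1) : ℝ) * ((n + 1).choose r : ℝ))
    = ((n : ℝ) + 1) * ((n.choose r : ℝ) * ((n + 2).choose (r + 1) : ℝ)) := by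
  have h1 : ((n + 1 + 1 : ℕ) : ℝ) * ((n + 1).choose r : ℝ)
      = ((n + 2).choose (r + 1) : ℝ) * ((r + 1 : ℕ) : ℝ) := by
    exact_mod_cast Nat.add_one_mul_choose_eq (n + 1) r
  have h2 : ((n + 1 : ℕ) : ℝ) * (n.choose r : ℝ)
      = ((n + 1).choose (r + 1) : ℝ) * ((r + 1 : ℕ) : ℝ) := by
    exact_mod_cast Nat.add_one_mul_choose_eq n r
  push_cast at h1 h2
  have : ((n : ℝ) + 1 + 1) = n + 2 := by ring
  rw [this] at h1
  linear_combination ((n + 1).choose (r + 1) : ℝ) * h1 - ((n + 2).choose (r + 1) : ℝ) * h2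

lemma aux_psi_rec (n : ℕ) (z : ℝ) :
    ((n : ℝ) + 2) * psi (n + 1) z = ((n : ℝ) + 1) * ((1 + z) * psi n z + 2 * z * phi n z) := by
  have e1 : ((n : ℝ) + 2) * psi (n + 1) z = ((n : ℝ) + 1) * ∑ r ∈ Finset.range (n + 1),
      ((n.choose r : ℝ) * ((n + 2).choose (r + 1) : ℝ)) * z ^ (r + 1) := by
    unfold psi
    rw [Finset.mul_sum, Finset.mul_sum]
    refine Finset.sum_congr rfl fun r _ => ?_
    linear_combination z ^ (r + 1) * aux_choose n r
  rw [e1]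
  congr 1
  have e3 : psi n z = ∑ r ∈ Finset.range (n + 1),
      (n.choose (r + 1) : ℝ) * (n.choose r : ℝ) * z ^ (r + 1) := by
    unfold psi
    rw [Finset.sum_range_succ]
    simp
  have e4 : z * phi n z = ∑ r ∈ Finset.range (n + 1), (n.choose r : ℝ) ^ 2 * z ^ (r + 1) := by
    unfold phi
    rw [Finset.mul_sum]
    refine Finset.sum_congr rfl fun r _ => ?_
    ring
  have e5 : ∑ r ∈ Finset.range (n + 1),
      ((n.choose r : ℝ) * (((n + 1).choose r : ℝ) - (n.choose r : ℝ))) * z ^ (r + 1)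
      = z * psi n z := by
    unfold psi
    rw [Finset.sum_range_succ', Finset.mul_sum]
    simp only [Nat.choose_succ_succ, Nat.choose_zero_right]
    push_cast
    simp only [sub_self, mul_zero, zero_mul, add_zero]
    refine Finset.sum_congr rfl fun r _ => ?_
    ring
  have : (1 + z) * psi n z + 2 * z * phi n z = psi n z + z * psi n z + 2 * (z * phi n z) := by ring
  rw [this, ← e5, e4, e3, Finset.mul_sum, ← Finset.sum_add_distrib, ← Finset.sum_add_distrib]
  refine Finset.sum_congr rfl fun r _ => ?_
  have h1 : ((n + 2).choose (r + 1) : ℝ) = ((n + 1).choose r : ℝ) + ((n.choose r : ℝ) +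
    (n.choose (r + 1) : ℝ)) := by
    rw [Nat.choose_succ_succ, Nat.choose_succ_succ n r]; push_cast; ring
  rw [h1]
  ring

lemma aux_phi_pos (n : ℕ) (z : ℝ) (hz : 0 < z) : 0 < phi n z := by
  unfold phi
  refine Finset.sum_pos (fun r hr => ?_) ⟨0, by simp⟩
  have : 0 < n.choose r := Nat.choose_pos (by simp at hr; omega)
  positivity

lemma aux_psi_nonneg (n : ℕ) (z : ℝ) (hz : 0 < z) : 0 ≤ psi n z := by
  unfold psi
  exact Finset.sum_nonneg fun r hr => by positivity

lemma aux_step (a P S z : ℝ) (ha : 0 ≤ a) (P' S' : ℝ) (hz : 0 < z) (hz1 : z < 1)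
    (hP : 0 < P) (hS : 0 ≤ S) (hlt : S ^ 2 < z * P ^ 2)
    (hB : (2 * a + 2) * S ^ 2 + (1 + z) * S * P - 2 * a * z * P ^ 2 ≤ 0)
    (h1 : P' = (1 + z) * P + 2 * S)
    (h2 : (a + 2) * S' = (a + 1) * ((1 + z) * S + 2 * z * P)) :
    (2 * (a + 1) + 2) * S' ^ 2 + (1 + z) * S' * P' - 2 * (a + 1) * z * P' ^ 2 < 0 := by
  have hc : 0 < (1 - z) ^ 2 := by have : 0 < 1 - z := by linarith
                                  positivity
  have hS' : S' = (a + 1) / (a + 2) * ((1 + z) * S + 2 * z * P) := by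
    field_simp
    linarith
  have key : (2 * (a + 1) + 2) * S' ^ 2 + (1 + z) * S' * P' - 2 * (a + 1) * z * P' ^ 2
      = (a + 1) / (a + 2) * ((1 - z) ^ 2 * (((2 * a + 2) * S ^ 2 + (1 + z) * S * P
        - 2 * a * z * P ^ 2) + 2 * (S ^ 2 - z * P ^ 2))) := by
    rw [hS', h1]
    field_simp
    ring
  rw [key]
  have : 0 < (a + 1) / (a + 2) := by positivity
  exact mul_neg_of_pos_of_neg this (mul_neg_of_pos_of_neg hc (by linarith))

lemma aux_main (n : ℕ) (z : ℝ) (hz : 0 < z) (hz1 : z < 1) :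
    psi n z ^ 2 < z * phi n z ^ 2 ∧
    (2 * n + 2) * psi n z ^ 2 + (1 + z) * psi n z * phi n z - 2 * n * z * phi n z ^ 2 ≤ 0 ∧
    (1 ≤ n →
    (2 * n + 2) * psi n z ^ 2 + (1 + z) * psi n z * phi n z - 2 * n * z * phi n z ^ 2 < 0) := by
  induction n with
  | zero => simp [phi, psi, hz]
  | succ n ih =>
    obtain ⟨i1, i2, -⟩ := ih
    have h := aux_step n (phi n z) (psi n z) z (by positivity) _ _ hz hz1 (aux_phi_pos n z hz)
      (aux_psi_nonneg n z hz) i1 i2 (aux_phi_rec n z) (aux_psi_rec n z)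
    push_cast
    refine ⟨?_, h.le, fun _ => h⟩
    have p1 := aux_phi_pos (n + 1) z hz
    have p2 := aux_psi_nonneg (n + 1) z hz
    have h3 : 0 ≤ (1 + z) * psi (n + 1) z * phi (n + 1) z := by positivity
    have hn : (0 : ℝ) < 2 * (n + 1) := by positivity
    by_contra hcon
    push Not at hcon
    have := mul_le_mul_of_nonneg_left hcon hn.le
    nlinarith [sq_nonneg (psi (n + 1) z)]

lemma aux_J (n : ℕ) (hn : 1 ≤ n) (p q : ℝ) (hq : 0 < q) (hqp : q < p)
    (hpq1 : p + q < 1) (hpL : p ≤ 1 / (2 * n + 1) + q) : 0 < J n q p := by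
  have hp : 0 < 1 - p := by linarith
  have hq1 : 0 < 1 - q := by linarith
  have hp0 : 0 < p := by linarith
  unfold J
  set z := p * q / ((1 - p) * (1 - q)) with hz
  have hz0 : 0 < z := by positivity
  have hz1 : z < 1 := by
    rw [hz, div_lt_one (by positivity)]; nlinarith
  obtain ⟨-, -, h⟩ := aux_main n z hz0 hz1
  specialize h hn
  have hP := aux_phi_pos n z hz0
  have hS := aux_psi_nonneg n z hz0
  set x := q / (1 - q) with hx
  have hx0 : 0 < x := by positivity
  have hQ : 0 ≤ (2 * n + 2) * x ^ 2 + (1 + z) * x - 2 * n * z := by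
    have h1 : (p - q) * (2 * n + 1) ≤ 1 := by
      have : p - q ≤ 1 / (2 * n + 1) := by linarith
      rwa [le_div_iff₀ (by positivity)] at this
    have : (2 * n + 2) * x ^ 2 + (1 + z) * x - 2 * n * z
        = q / ((1 - p) * (1 - q) ^ 2) * (1 - (p - q) * (2 * n + 1)) := by
      rw [hx, hz]
      field_simp
      ring
    rw [this]
    have : 0 ≤ 1 - (p - q) * (2 * n + 1) := by linarith
    positivity
  by_contra hcon
  push Not at hcon
  have hle : x * phi n z ≤ psi n z := by linarith
  have a1 : (x * phi n z) ^ 2 ≤ psi n z ^ 2 := by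
    apply pow_le_pow_left₀ (by positivity) hle
  have a2 : (1 + z) * (x * phi n z) * phi n z ≤ (1 + z) * psi n z * phi n z := by gcongr
  have a3 : (2 * n + 2) * (x * phi n z) ^ 2 ≤ (2 * n + 2) * psi n z ^ 2 := by gcongr
  have a4 : 0 ≤ ((2 * n + 2) * x ^ 2 + (1 + z) * x - 2 * n * z) * phi n z ^ 2 := by positivity
  nlinarith

noncomputable def bb (n : ℕ) (p : ℝ) (r : ℕ) : ℝ := (n.choose r : ℝ) * p ^ r * (1 - p) ^ (n - r)

noncomputable def TT (n : ℕ) (q : ℝ) (r : ℕ) : ℝ := ∑ s ∈ Finset.Icc (r + 1) n, bb n q s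

lemma bb_zero (n : ℕ) (p : ℝ) (r : ℕ) (h : n < r) : bb n p r = 0 := by
  simp [bb, Nat.choose_eq_zero_of_lt h]

lemma bb_succ (n : ℕ) (p : ℝ) (r : ℕ) :
    bb (n + 1) p (r + 1) = p * bb n p r + (1 - p) * bb n p (r + 1) := by
  unfold bb
  rw [Nat.choose_succ_succ]
  push_cast
  rcases Nat.lt_or_ge r n with h | h
  · obtain ⟨k, rfl⟩ : ∃ k, n = r + 1 + k := ⟨n - (r + 1), by omega⟩
    have e2 : r + 1 + k - r = k + 1 := by omega
    have e3 : r + 1 + k - (r + 1) = k := by omega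
    simp only [Nat.add_sub_add_right, Nat.succ_eq_add_one, e2, e3]
    ring
  · rw [Nat.choose_eq_zero_of_lt (show n < r + 1 by omega)]
    push_cast
    ring

lemma bb_succ_zero (n : ℕ) (p : ℝ) : bb (n + 1) p 0 = (1 - p) * bb n p 0 := by
  simp [bb]; ring

lemma TT_succ (n : ℕ) (q : ℝ) (r : ℕ) : TT n q r = bb n q (r + 1) + TT n q (r + 1) := by
  unfold TT
  rcases Nat.lt_or_ge r n with h | h
  · rw [← Finset.add_sum_Ioc_eq_sum_Icc (show r + 1 ≤ n by omega)]
    congr 2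
    ext s
    simp only [Finset.mem_Ioc, Finset.mem_Icc]
    omega
  · rw [Finset.Icc_eq_empty (by omega), Finset.Icc_eq_empty (by omega), bb_zero _ _ _ (by omega)]
    simp

lemma TT_step (n : ℕ) (q : ℝ) (k : ℕ) : ∀ r, n + 1 ≤ r + k →
    TT (n + 1) q r = TT n q r + q * bb n q r := by
  induction k with
  | zero =>
    intro r hr
    rw [bb_zero _ _ _ (by omega)]
    unfold TT
    rw [Finset.Icc_eq_empty (by omega), Finset.Icc_eq_empty (by omega)]
    simp
  | succ k ih =>
    intro r hr
    rw [TT_succ, ih (r + 1) (by omega), bb_succ, TT_succ n q r]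
    ring

lemma f_eq (n : ℕ) (p q : ℝ) : f n p q = ∑ r ∈ Finset.range (n + 1), bb n p r * TT n q r := by
  unfold f TT bb
  refine Finset.sum_congr rfl fun r _ => ?_
  rw [Finset.mul_sum]

lemma f_diff (n : ℕ) (p q : ℝ) : f (n + 1) p q - f n p q =
    ∑ r ∈ Finset.range (n + 1), bb n p r * ((1 - p) * q * bb n q r - p * (1 - q) * bb n q (r + 1)) := by
  rw [f_eq, f_eq, Finset.sum_range_succ', bb_succ_zero]
  simp only [bb_succ, add_mul, Finset.sum_add_distrib]
  have e : ∑ r ∈ Finset.range (n + 1), (1 - p) * bb n p (r + 1) * TT (n + 1) q (r + 1)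
      + (1 - p) * bb n p 0 * TT (n + 1) q 0
      = ∑ r ∈ Finset.range (n + 1), (1 - p) * bb n p r * TT (n + 1) q r := by
    rw [← Finset.sum_range_succ' (fun r => (1 - p) * bb n p r * TT (n + 1) q r),
      Finset.sum_range_succ, bb_zero n p (n + 1) (by omega)]
    simp
  rw [add_assoc, e, ← Finset.sum_add_distrib, ← Finset.sum_sub_distrib]
  refine Finset.sum_congr rfl fun r _ => ?_
  rw [TT_step n q (n + 1) (r + 1) (by omega), TT_step n q (n + 1) r (by omega), TT_succ n q r]
  ring

lemma f_diff_J (n : ℕ) (p q : ℝ) (hp : 0 < 1 - p) (hq : 0 < 1 - q) :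
    f (n + 1) p q - f n p q = ((1 - p) * (1 - q)) ^ (n + 1) * J n q p := by
  rw [f_diff]
  have e3 : psi n (p * q / ((1 - p) * (1 - q))) = ∑ r ∈ Finset.range (n + 1),
      (n.choose (r + 1) : ℝ) * (n.choose r : ℝ) * (p * q / ((1 - p) * (1 - q))) ^ (r + 1) := by
    unfold psi
    rw [Finset.sum_range_succ]
    simp
  unfold J
  rw [e3]
  unfold phi
  rw [Finset.mul_sum, ← Finset.sum_sub_distrib, Finset.mul_sum]
  refine Finset.sum_congr rfl fun r hr => ?_
  have hr' : r ≤ n := by simp at hr; omega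
  unfold bb
  rcases Nat.lt_or_ge r n with h | h
  · obtain ⟨k, rfl⟩ : ∃ k, n = r + 1 + k := ⟨n - (r + 1), by omega⟩
    have e2 : r + 1 + k - r = k + 1 := by omega
    have e3 : r + 1 + k - (r + 1) = k := by omega
    rw [e2, e3, div_pow, div_pow]
    generalize ((r + 1 + k).choose r : ℝ) = A
    generalize ((r + 1 + k).choose (r + 1) : ℝ) = B
    have hp' := hp.ne'
    have hq' := hq.ne'
    generalize 1 - p = u at *
    generalize 1 - q = v at *
    field_simp
    ring
  · obtain rfl : r = n := by omega
    rw [Nat.choose_eq_zero_of_lt (show r < r + 1 by omega), div_pow]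
    simp only [Nat.choose_self, Nat.sub_self]
    have hp' := hp.ne'
    have hq' := hq.ne'
    generalize 1 - p = u at *
    generalize 1 - q = v at *
    push_cast
    field_simp
    ring

theorem statement7 (n : ℕ) (hn : 1 ≤ n) (p q : ℝ) (hq : 0 < q) (hqp : q < p)
    (hpq1 : p + q < 1) (hpL : p ≤ 1 / (2 * n + 1) + q) :
    0 < J n q p ∧ f n p q < f (n + 1) p q := by
  have hJ := aux_J n hn p q hq hqp hpq1 hpL
  refine ⟨hJ, ?_⟩
  have hp : 0 < 1 - p := by linarith
  have hq1 : 0 < 1 - q := by linarith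
  have h := f_diff_J n p q hp hq1
  have : 0 < ((1 - p) * (1 - q)) ^ (n + 1) * J n q p := by positivity
  linarith
end

section
/- (Upper bound on the optimal length) For all reals p, q with 0 < q < p < 1, there exists a natural number n with n ≤ ⌈ max(1−p, q) / (p−q) ⌉ such that f(m, p, q) ≤ f(n, p, q) for all natural numbers m. -/
noncomputable def ebin (p : ℝ) (n : ℕ) (φ : ℕ → ℝ) : ℝ :=
  ∑ r ∈ Finset.range (n + 1), (n.choose r : ℝ) * p ^ r * (1 - p) ^ (n - r) * φ r

theorem ebin_succ (p : ℝ) (n : ℕ) (φ : ℕ → ℝ) :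
    ebin p (n + 1) φ = ebin p n (fun r => p * φ (r + 1) + (1 - p) * φ r) := by
  have h2 : ∑ r ∈ Finset.range (n + 1), (n.choose r : ℝ) * p ^ r * (1 - p) ^ (n + 1 - r) * φ r
      = ∑ r ∈ Finset.range (n + 1),
        (n.choose (r + 1) : ℝ) * p ^ (r + 1) * (1 - p) ^ (n - r) * φ (r + 1)
        + (1 - p) ^ (n + 1) * φ 0 := by
    have := Finset.sum_range_succ
      (fun r => (n.choose r : ℝ) * p ^ r * (1 - p) ^ (n + 1 - r) * φ r) (n + 1)
    rw [Finset.sum_range_succ'] at this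
    simp at this
    linarith
  unfold ebin
  rw [Finset.sum_range_succ']
  have h3 : ∀ r ∈ Finset.range (n + 1),
      (n.choose r : ℝ) * p ^ r * (1 - p) ^ (n - r) * (p * φ (r + 1) + (1 - p) * φ r)
      = (n.choose r : ℝ) * p ^ (r + 1) * (1 - p) ^ (n - r) * φ (r + 1)
        + (n.choose r : ℝ) * p ^ r * (1 - p) ^ (n + 1 - r) * φ r := by
    intro r hr
    have : r ≤ n := by simpa [Nat.lt_succ_iff] using hr
    rw [Nat.succ_sub this, pow_succ, pow_succ]
    ring
  rw [Finset.sum_congr rfl h3, Finset.sum_add_distrib, h2, ← add_assoc,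
    ← Finset.sum_add_distrib]
  congr 1
  · apply Finset.sum_congr rfl
    intro r _
    rw [Nat.choose_succ_succ, Nat.add_sub_add_right]
    push_cast
    ring
  · simp

theorem ebin_add (p : ℝ) (n : ℕ) (φ ψ : ℕ → ℝ) :
    ebin p n (fun r => φ r + ψ r) = ebin p n φ + ebin p n ψ := by
  simp only [ebin, ← Finset.sum_add_distrib, mul_add]

theorem ebin_smul (p c : ℝ) (n : ℕ) (φ : ℕ → ℝ) :
    ebin p n (fun r => c * φ r) = c * ebin p n φ := by
  simp only [ebin, Finset.mul_sum]
  exact Finset.sum_congr rfl fun _ _ => by ring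

theorem ebin_nonneg (p : ℝ) (h0 : 0 ≤ p) (h1 : p ≤ 1) (n : ℕ) (φ : ℕ → ℝ) (h : ∀ r, 0 ≤ φ r) :
    0 ≤ ebin p n φ := by
  have : 0 ≤ 1 - p := by linarith
  exact Finset.sum_nonneg fun r _ => mul_nonneg (by positivity) (h r)

noncomputable def eb2 (p q : ℝ) (n : ℕ) (φ : ℕ → ℕ → ℝ) : ℝ :=
  ebin p n (fun r => ebin q n (fun s => φ r s))

theorem eb2_add (p q : ℝ) (n : ℕ) (φ ψ : ℕ → ℕ → ℝ) :
    eb2 p q n (fun r s => φ r s + ψ r s) = eb2 p q n φ + eb2 p q n ψ := by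
  simp only [eb2, ebin_add]

theorem eb2_smul (p q c : ℝ) (n : ℕ) (φ : ℕ → ℕ → ℝ) :
    eb2 p q n (fun r s => c * φ r s) = c * eb2 p q n φ := by
  simp only [eb2, ebin_smul]

theorem eb2_succ (p q : ℝ) (n : ℕ) (φ : ℕ → ℕ → ℝ) :
    eb2 p q (n + 1) φ = (p * q) * eb2 p q n (fun r s => φ (r + 1) (s + 1))
      + (p * (1 - q)) * eb2 p q n (fun r s => φ (r + 1) s)
      + (q * (1 - p)) * eb2 p q n (fun r s => φ r (s + 1))
      + ((1 - p) * (1 - q)) * eb2 p q n φ := by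
  simp only [eb2, ebin_succ, ebin_add, ebin_smul]
  ring

noncomputable def PD (p q : ℝ) (n : ℕ) (k : ℤ) : ℝ :=
  eb2 p q n (fun r s => if (s : ℤ) - r = k then 1 else 0)

theorem PD_succ (p q : ℝ) (n : ℕ) (k : ℤ) :
    PD p q (n + 1) k = (p * q + (1 - p) * (1 - q)) * PD p q n k
      + (q * (1 - p)) * PD p q n (k - 1) + (p * (1 - q)) * PD p q n (k + 1) := by
  have e1 : ∀ r s : ℕ, (((s + 1 : ℕ) : ℤ) - ((r + 1 : ℕ) : ℤ) = k) = ((s : ℤ) - r = k) := by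
    intro r s; apply propext; push_cast; constructor <;> intro h <;> linarith
  have e2 : ∀ r s : ℕ, (((s : ℕ) : ℤ) - ((r + 1 : ℕ) : ℤ) = k) = ((s : ℤ) - r = k + 1) := by
    intro r s; apply propext; push_cast; constructor <;> intro h <;> linarith
  have e3 : ∀ r s : ℕ, (((s + 1 : ℕ) : ℤ) - (r : ℤ) = k) = ((s : ℤ) - r = k - 1) := by
    intro r s; apply propext; push_cast; constructor <;> intro h <;> linarith
  unfold PD
  rw [eb2_succ]
  simp only [e1, e2, e3]
  ring

theorem PD_zero (p q : ℝ) (k : ℤ) : PD p q 0 k = if k = 0 then 1 else 0 := by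
  simp [PD, eb2, ebin, eq_comm]

theorem PD_nonneg (p q : ℝ) (hp : 0 ≤ p) (hp1 : p ≤ 1) (hq : 0 ≤ q) (hq1 : q ≤ 1) (n : ℕ) (k : ℤ) :
    0 ≤ PD p q n k := by
  apply ebin_nonneg p hp hp1
  intro r
  apply ebin_nonneg q hq hq1
  intro s
  dsimp only
  split_ifs <;> norm_num

theorem f_eq_s9 (p q : ℝ) (n : ℕ) : f n p q = eb2 p q n (fun r s => if r < s then 1 else 0) := by
  unfold f eb2 ebin
  apply Finset.sum_congr rfl
  intro r _
  rw [Finset.mul_sum]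
  have : Finset.Icc (r + 1) n = (Finset.range (n + 1)).filter (fun s => r < s) := by
    ext s; simp; omega
  rw [this, Finset.sum_filter]
  apply Finset.sum_congr rfl
  intro s _
  by_cases h : r < s <;> simp [h]

theorem f_succ (p q : ℝ) (n : ℕ) :
    f (n + 1) p q = f n p q + (q * (1 - p)) * PD p q n 0 - (p * (1 - q)) * PD p q n 1 := by
  have e2 : ∀ r s : ℕ, (if r + 1 < s then (1 : ℝ) else 0)
      = (if r < s then (1 : ℝ) else 0) + (-1) * (if (s : ℤ) - r = 1 then (1 : ℝ) else 0) := by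
    intro r s
    split_ifs <;> first | omega | norm_num
  have e3 : ∀ r s : ℕ, (if r < s + 1 then (1 : ℝ) else 0)
      = (if r < s then (1 : ℝ) else 0) + (if (s : ℤ) - r = 0 then (1 : ℝ) else 0) := by
    intro r s
    split_ifs <;> first | omega | norm_num
  rw [f_eq_s9, f_eq_s9, eb2_succ]
  simp only [e2, e3, eb2_add, eb2_smul, add_lt_add_iff_right]
  unfold PD
  ring

theorem PD_diff (p q : ℝ) (n : ℕ) : ∀ k : ℤ,
    (k : ℝ) * PD p q (n + 1) k
      = (n + 1) * ((q * (1 - p)) * PD p q n (k - 1) - (p * (1 - q)) * PD p q n (k + 1)) := by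
  induction n with
  | zero =>
    intro k
    rw [PD_succ]
    simp only [PD_zero]
    by_cases h0 : k = 0
    · subst h0; simp
    by_cases h1 : k = 1
    · subst h1; simp
    by_cases h2 : k = -1
    · subst h2; simp
    rw [if_neg h0, if_neg (by omega), if_neg (by omega)]; simp
  | succ n ih =>
    intro k
    have i0 := ih k
    have i1 := ih (k - 1)
    have i2 := ih (k + 1)
    have r1 := PD_succ p q n (k - 1)
    have r2 := PD_succ p q n (k + 1)
    rw [PD_succ p q (n + 1) k]
    simp only [sub_add_cancel, add_sub_cancel_right] at *
    push_cast at *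
    linear_combination (p * q + (1 - p) * (1 - q)) * i0 + (q * (1 - p)) * i1 + (p * (1 - q)) * i2
      - (n + 1) * (q * (1 - p)) * r1 + (n + 1) * (p * (1 - q)) * r2

theorem inv_lem (u v : ℝ) (hv : 0 ≤ v) (huv : v ≤ u) (A B : ℕ → ℝ)
    (hA : ∀ n, 0 ≤ A n) (hB : ∀ n, 0 ≤ B n) (hB0 : B 0 = 0)
    (rA : ∀ n, A (n + 1) = (u + v) * A n + 2 * (u * v) * B n)
    (rB : ∀ n : ℕ, (n + 2) * B (n + 1) = (n + 1) * ((u + v) * B n + 2 * A n)) (n : ℕ) :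
    n * (A n ^ 2 - u * v * B n ^ 2) ≤ u * A n * B n + u * v * B n ^ 2 := by
  have hu : 0 ≤ u := hv.trans huv
  induction n with
  | zero => simp [hB0]
  | succ n ih =>
    have a0 := hA n
    have b0 := hB n
    have hn : (0 : ℝ) ≤ n := n.cast_nonneg
    have hBB : B (n + 1) = (n + 1) / (n + 2) * ((u + v) * B n + 2 * A n) := by
      have := rB n
      field_simp
      linarith
    have key : (n + 2) * A (n + 1) ^ 2 - (n + 1) * (u * v) * ((u + v) * B n + 2 * A n) ^ 2
        - u * A (n + 1) * ((u + v) * B n + 2 * A n) ≤ 0 := by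
      rw [rA n]
      have h1 : (n + 1) * (A n ^ 2 - u * v * B n ^ 2) ≤ A n * (A n + u * B n) := by nlinarith
      have h2 := mul_le_mul_of_nonneg_left h1 (sq_nonneg (u - v))
      have h3 : 0 ≤ (u - v) * (A n + u * B n) * (2 * v * A n + 2 * (u * v) * B n) := by
        have : 0 ≤ u - v := by linarith
        positivity
      linarith
    have h4 := mul_nonpos_of_nonneg_of_nonpos
      (show (0 : ℝ) ≤ (n + 1) / (n + 2) by positivity) key
    rw [hBB]
    push_cast
    refine sub_nonpos.1 (le_of_eq_of_le ?_ h4)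
    field_simp
    ring

theorem fin_lem (a b M A B n : ℝ) (ha : 0 < a) (hab : a < b) (hM : 0 ≤ M)
    (hB : 0 ≤ B) (hn : M + a ≤ n * (b - a))
    (h : n * (A ^ 2 - a * b * B ^ 2) ≤ M * A * B + a * b * B ^ 2) : A ≤ b * B := by
  by_contra! hc
  have hb : 0 < b := ha.trans hab
  have hbB : 0 ≤ b * B := by positivity
  have hA : 0 < A := by linarith
  have h0 : 0 ≤ A ^ 2 - a * b * B ^ 2 := by
    have h1 : (b * B) ^ 2 ≤ A ^ 2 := by gcongr
    have h2 : a * b * B ^ 2 ≤ b * b * B ^ 2 := by gcongr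
    nlinarith
  have h1 := mul_le_mul_of_nonneg_right hn h0
  have h2 := mul_le_mul_of_nonneg_left h (sub_pos.2 hab).le
  have h3 : 0 ≤ M * ((A - b * B) * (A + a * B)) := by
    have : 0 ≤ A - b * B := by linarith
    positivity
  have h4 : 0 < a * ((A - b * B) * (A + b * B)) := by
    have : 0 < A - b * B := by linarith
    positivity
  nlinarith

theorem step (p q : ℝ) (hq : 0 < q) (hqp : q < p) (hp1 : p < 1) (n : ℕ)
    (hn : max (1 - p) q ≤ n * (p - q)) : f (n + 1) p q ≤ f n p q := by
  have hp : 0 < p := hq.trans hqp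
  have h1p : 0 < 1 - p := by linarith
  have h1q : 0 < 1 - q := by linarith
  obtain ⟨a, hadef⟩ : ∃ a, a = q * (1 - p) := ⟨_, rfl⟩
  have ha : 0 < a := by rw [hadef]; positivity
  have nn := PD_nonneg p q hp.le hp1.le hq.le (by linarith)
  have hA : ∀ n, 0 ≤ PD p q n 0 := fun n => nn n 0
  have hB : ∀ n, 0 ≤ PD p q n 1 / a := fun n => div_nonneg (nn n 1) ha.le
  have hB0 : PD p q 0 1 / a = 0 := by simp [PD_zero]
  have rA : ∀ n, PD p q (n + 1) 0 = (p * q + (1 - p) * (1 - q)) * PD p q n 0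
      + 2 * (p * q * ((1 - p) * (1 - q))) * (PD p q n 1 / a) := by
    intro n
    have h1 := PD_succ p q n 0
    have h2 := PD_diff p q n 0
    have h3 : (q * (1 - p)) * PD p q n (0 - 1) - (p * (1 - q)) * PD p q n (0 + 1) = 0 := by
      have : (n + 1 : ℝ) ≠ 0 := by positivity
      rw [Int.cast_zero, zero_mul] at h2
      exact (mul_eq_zero.1 h2.symm).resolve_left this
    have h4 : 2 * (p * q * ((1 - p) * (1 - q))) * (PD p q n 1 / a)
        = 2 * (p * (1 - q)) * PD p q n 1 := by
      field_simp
      rw [hadef]; ring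
    rw [h4]
    simp only [zero_add] at *
    linarith
  have rB : ∀ n : ℕ, (n + 2) * (PD p q (n + 1) 1 / a)
      = (n + 1) * ((p * q + (1 - p) * (1 - q)) * (PD p q n 1 / a) + 2 * PD p q n 0) := by
    intro n
    have h1 := PD_succ p q n 1
    have h2 := PD_diff p q n 1
    simp only [sub_self, Int.cast_one, one_mul] at h1 h2
    rw [← hadef] at h1 h2
    field_simp
    linear_combination (n + 1) * h1 + h2
  have hb : a < p * (1 - q) := by rw [hadef]; nlinarith
  have hfin : PD p q n 0 ≤ (p * (1 - q)) * (PD p q n 1 / a) := by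
    rcases le_total ((1 - p) * (1 - q)) (p * q) with h | h
    · have := inv_lem (p * q) ((1 - p) * (1 - q)) (by positivity) h _ _ hA hB hB0 rA rB n
      refine fin_lem a (p * (1 - q)) (p * q) _ _ n ha hb (by positivity) (hB n) ?_ ?_
      · have := (le_max_right _ _).trans hn
        rw [hadef]; nlinarith
      · have e : a * (p * (1 - q)) = p * q * ((1 - p) * (1 - q)) := by rw [hadef]; ring
        rw [e]; exact this
    · have := inv_lem ((1 - p) * (1 - q)) (p * q) (by positivity) h _ _ hA hB hB0
        (fun n => by rw [rA n]; ring) (fun n => by rw [rB n]; ring) n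
      refine fin_lem a (p * (1 - q)) ((1 - p) * (1 - q)) _ _ n ha hb (by positivity) (hB n) ?_ ?_
      · have := (le_max_left _ _).trans hn
        rw [hadef]; nlinarith
      · have e : a * (p * (1 - q)) = (1 - p) * (1 - q) * (p * q) := by rw [hadef]; ring
        rw [e]; exact this
  rw [f_succ, ← hadef]
  have := mul_le_mul_of_nonneg_left hfin ha.le
  have e : a * (p * (1 - q) * (PD p q n 1 / a)) = p * (1 - q) * PD p q n 1 := by
    field_simp
  linarith

theorem statement9 (p q : ℝ) (hq : 0 < q) (hqp : q < p) (hp1 : p < 1) :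
    ∃ n : ℕ, n ≤ ⌈max (1 - p) q / (p - q)⌉₊ ∧ ∀ m : ℕ, f m p q ≤ f n p q := by
  set N := ⌈max (1 - p) q / (p - q)⌉₊ with hN
  have hpq : 0 < p - q := sub_pos.2 hqp
  have hdec : ∀ k, f (N + k) p q ≤ f N p q := by
    intro k
    induction k with
    | zero => simp
    | succ k ih =>
      refine (step p q hq hqp hp1 (N + k) ?_).trans ih
      have h1 : max (1 - p) q / (p - q) ≤ N := Nat.le_ceil _
      rw [div_le_iff₀ hpq] at h1
      push_cast
      have : (0 : ℝ) ≤ k * (p - q) := by positivity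
      linarith
  obtain ⟨n, hn, hmax⟩ := Finset.exists_max_image (Finset.range (N + 1)) (fun n => f n p q)
    ⟨0, by simp⟩
  refine ⟨n, by simpa [Nat.lt_succ_iff] using hn, fun m => ?_⟩
  rcases le_total m N with h | h
  · exact hmax m (by simpa [Nat.lt_succ_iff] using h)
  · obtain ⟨k, rfl⟩ := Nat.exists_eq_add_of_le h
    exact (hdec k).trans (hmax N (by simp))
end

section
/- (Closed form by telescoping) For every integer n ≥ 0 and all reals p, q with 0 < p < 1 and 0 < q < 1, setting z = pq/((1−p)(1−q)) and c = (1−p)(1−q), one has f(n, p, q) = (1/2) · ( 1 − c^n · φ_n(z) − (p−q) · Σ_{k=0}^{n−1} c^k · φ_k(z) ). -/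
noncomputable def BB (n : ℕ) (p : ℝ) (r : ℕ) : ℝ := (n.choose r : ℝ) * p ^ r * (1 - p) ^ (n - r)

noncomputable def EE (n : ℕ) (p : ℝ) (g : ℕ → ℝ) : ℝ := ∑ r ∈ Finset.range (n + 1), BB n p r * g r

theorem BB_zero (n : ℕ) (p : ℝ) : BB (n + 1) p 0 = (1 - p) * BB n p 0 := by
  simp [BB, pow_succ, mul_comm]

theorem BB_top (n : ℕ) (p : ℝ) : BB n p (n + 1) = 0 := by
  simp [BB]

theorem BB_succ (n : ℕ) (p : ℝ) (r : ℕ) :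
    BB (n + 1) p (r + 1) = p * BB n p r + (1 - p) * BB n p (r + 1) := by
  unfold BB
  rw [Nat.choose_succ_succ, Nat.add_sub_add_right]
  rcases lt_or_ge r n with h | h
  · obtain ⟨k, rfl⟩ := Nat.exists_eq_add_of_lt h
    have h1 : r + k + 1 - r = k + 1 := by omega
    have h2 : r + k + 1 - (r + 1) = k := by omega
    rw [h1, h2]
    push_cast
    ring
  · rw [Nat.choose_eq_zero_of_lt (show n < r + 1 by omega)]
    push_cast
    ring

theorem EE_succ (n : ℕ) (p : ℝ) (g : ℕ → ℝ) :
    EE (n + 1) p g = EE n p (fun r => p * g (r + 1) + (1 - p) * g r) := by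
  unfold EE
  rw [Finset.sum_range_succ' _ (n + 1)]
  have h : ∑ r ∈ Finset.range (n + 1), BB n p r * g r
      = ∑ r ∈ Finset.range (n + 1), BB n p (r + 1) * g (r + 1) + BB n p 0 * g 0 := by
    rw [← Finset.sum_range_succ' (fun r => BB n p r * g r) (n + 1),
      Finset.sum_range_succ _ (n + 1), BB_top]
    ring
  have h2 : ∑ r ∈ Finset.range (n + 1), BB n p r * (p * g (r + 1) + (1 - p) * g r)
      = p * ∑ r ∈ Finset.range (n + 1), BB n p r * g (r + 1)
        + (1 - p) * ∑ r ∈ Finset.range (n + 1), BB n p r * g r := by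
    rw [Finset.mul_sum, Finset.mul_sum, ← Finset.sum_add_distrib]
    exact Finset.sum_congr rfl fun r _ => by ring
  rw [h2, h, BB_zero]
  simp only [BB_succ, add_mul, Finset.sum_add_distrib, mul_add, Finset.mul_sum, mul_assoc]
  ring

theorem EE_one (n : ℕ) (p : ℝ) : EE n p (fun _ => 1) = 1 := by
  induction n with
  | zero => simp [EE, BB]
  | succ n ih => rw [EE_succ]; convert ih using 2; ext; ring

theorem EE_add (n : ℕ) (p : ℝ) (g h : ℕ → ℝ) :
    EE n p (fun r => g r + h r) = EE n p g + EE n p h := by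
  simp [EE, mul_add, Finset.sum_add_distrib]

theorem EE_mul (n : ℕ) (p a : ℝ) (g : ℕ → ℝ) :
    EE n p (fun r => a * g r) = a * EE n p g := by
  simp only [EE, Finset.mul_sum]
  exact Finset.sum_congr rfl fun r _ => by ring

noncomputable def E2 (n : ℕ) (p q : ℝ) (g : ℕ → ℕ → ℝ) : ℝ := EE n p (fun r => EE n q (fun s => g r s))

theorem E2_add (n : ℕ) (p q : ℝ) (g h : ℕ → ℕ → ℝ) :
    E2 n p q (fun r s => g r s + h r s) = E2 n p q g + E2 n p q h := by
  simp only [E2, EE_add]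

theorem E2_mul (n : ℕ) (p q a : ℝ) (g : ℕ → ℕ → ℝ) :
    E2 n p q (fun r s => a * g r s) = a * E2 n p q g := by
  simp only [E2, EE_mul]

theorem E2_succ (n : ℕ) (p q : ℝ) (g : ℕ → ℕ → ℝ) :
    E2 (n + 1) p q g = E2 n p q (fun r s => p * (q * g (r+1) (s+1) + (1 - q) * g (r+1) s)
      + (1 - p) * (q * g r (s+1) + (1 - q) * g r s)) := by
  simp only [E2, EE_succ, EE_add, EE_mul]

noncomputable def sg (r s : ℕ) : ℝ := if r < s then 1 else if s < r then -1 else 0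
noncomputable def d0 (r s : ℕ) : ℝ := if r = s then 1 else 0
noncomputable def dp (r s : ℕ) : ℝ := if s = r + 1 then 1 else 0
noncomputable def dm (r s : ℕ) : ℝ := if r = s + 1 then 1 else 0

theorem sg_ss (r s : ℕ) : sg (r + 1) (s + 1) = sg r s := by simp [sg]
theorem sg_s (r s : ℕ) : sg r (s + 1) = sg r s + d0 r s + dm r s := by
  unfold sg d0 dm
  split_ifs <;> first | omega | norm_num
theorem sg_r (r s : ℕ) : sg (r + 1) s = sg r s - d0 r s - dp r s := by
  unfold sg d0 dp
  split_ifs <;> first | omega | norm_num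

theorem E2_d0 (n : ℕ) (p q : ℝ) :
    E2 n p q d0 = ∑ r ∈ Finset.range (n + 1), BB n p r * BB n q r := by
  unfold E2 EE d0
  refine Finset.sum_congr rfl fun r hr => ?_
  simp only [mul_ite, mul_one, mul_zero, Finset.sum_ite_eq, hr, if_true]

theorem E2_dm (n : ℕ) (p q : ℝ) :
    E2 n p q dm = ∑ s ∈ Finset.range (n + 1), BB n p (s + 1) * BB n q s := by
  unfold E2 EE dm
  simp only [Finset.mul_sum]
  rw [Finset.sum_comm]
  refine Finset.sum_congr rfl fun s hs => ?_
  simp only [mul_ite, mul_one, mul_zero, Finset.sum_ite_eq']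
  split_ifs with h
  · rfl
  · have : s = n := by simp at h hs; omega
    subst this
    simp [BB_top]

theorem E2_dp (n : ℕ) (p q : ℝ) :
    E2 n p q dp = ∑ s ∈ Finset.range (n + 1), BB n p s * BB n q (s + 1) := by
  unfold E2 EE dp
  refine Finset.sum_congr rfl fun s hs => ?_
  simp only [mul_ite, mul_one, mul_zero, Finset.sum_ite_eq']
  split_ifs with h
  · rfl
  · have : s = n := by simp at h hs; omega
    subst this
    simp [BB_top]

theorem E2_sym (n : ℕ) (p q : ℝ) :
    q * (1 - p) * E2 n p q dm = p * (1 - q) * E2 n p q dp := by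
  rw [E2_dm, E2_dp, Finset.mul_sum, Finset.mul_sum]
  refine Finset.sum_congr rfl fun r hr => ?_
  rcases lt_or_ge r n with h | h
  · obtain ⟨k, rfl⟩ := Nat.exists_eq_add_of_lt h
    have h1 : r + k + 1 - r = k + 1 := by omega
    have h2 : r + k + 1 - (r + 1) = k := by omega
    unfold BB
    rw [h1, h2]
    ring
  · have : r = n := by simp at hr; omega
    subst this
    simp [BB_top]

theorem E2_sg_succ (n : ℕ) (p q : ℝ) :
    E2 (n + 1) p q sg = E2 n p q sg + (q - p) * E2 n p q d0 := by
  have h : E2 (n + 1) p q sg = E2 n p q (fun r s => sg r s + ((q - p) * d0 r s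
      + (q * (1 - p) * dm r s + (-(p * (1 - q))) * dp r s))) := by
    rw [E2_succ]
    congr 1
    ext r s
    rw [sg_ss, sg_s, sg_r]
    ring
  rw [h, E2_add, E2_add, E2_add, E2_mul, E2_mul, E2_mul]
  linear_combination E2_sym n p q

theorem E2_sg (n : ℕ) (p q : ℝ) :
    E2 n p q sg = (q - p) * ∑ k ∈ Finset.range n, E2 k p q d0 := by
  induction n with
  | zero => simp [E2, EE, sg]
  | succ n ih => rw [E2_sg_succ, Finset.sum_range_succ, ih]; ring

theorem f_eq_s12 (n : ℕ) (p q : ℝ) :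
    f n p q = 1 / 2 * (1 + (E2 n p q sg + (-1) * E2 n p q d0)) := by
  have h1 : E2 n p q (fun _ _ => 1) = 1 := by simp only [E2, EE_one]
  have h : f n p q = E2 n p q (fun r s => 1 / 2 * (1 + (sg r s + (-1) * d0 r s))) := by
    unfold f E2 EE
    refine Finset.sum_congr rfl fun r hr => ?_
    rw [Finset.mul_sum]
    have hs : Finset.Icc (r + 1) n = (Finset.range (n + 1)).filter (fun s => r < s) := by
      ext s; simp; omega
    rw [hs, Finset.sum_filter]
    refine Finset.sum_congr rfl fun s _ => ?_
    have : (1 / 2 * (1 + (sg r s + (-1) * d0 r s)) : ℝ) = if r < s then 1 else 0 := by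
      unfold sg d0
      split_ifs <;> first | omega | norm_num
    beta_reduce
    rw [this]
    unfold BB
    split_ifs <;> ring
  rw [h, E2_mul, E2_add, E2_add, E2_mul, h1]

theorem E2_phi (n : ℕ) (p q : ℝ) (hp1 : p < 1) (hq1 : q < 1) :
    ((1 - p) * (1 - q)) ^ n * phi n (p * q / ((1 - p) * (1 - q))) = E2 n p q d0 := by
  rw [E2_d0, phi, Finset.mul_sum]
  refine Finset.sum_congr rfl fun r hr => ?_
  have hr' : r ≤ n := by simp at hr; omega
  obtain ⟨k, rfl⟩ := Nat.exists_eq_add_of_le hr'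
  have h1 : (1 - p) ≠ 0 := by linarith
  have h2 : (1 - q) ≠ 0 := by linarith
  unfold BB
  rw [Nat.add_sub_cancel_left, div_pow, pow_add]
  field_simp
  rw [mul_pow, mul_pow]
  ring

theorem statement12 (n : ℕ) (p q : ℝ) (hp : 0 < p) (hp1 : p < 1) (hq : 0 < q) (hq1 : q < 1)
    (z c : ℝ) (hz : z = p * q / ((1 - p) * (1 - q))) (hc : c = (1 - p) * (1 - q)) :
    f n p q =
      (1 / 2) * (1 - c ^ n * phi n z - (p - q) * ∑ k ∈ Finset.range n, c ^ k * phi k z) := by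
  subst hz hc
  simp only [E2_phi _ p q hp1 hq1]
  rw [f_eq_s12, E2_sg]
  ring
end
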